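/- Let Σ = {a,b}, let n ≥ 2, and let w ∈ Σ* be a word of length n. Then σ(Σ* w Σ*) = n² if and only if w ∈ {a^{n-1}b, ab^{n-1}, ba^{n-1}, b^{n-1}a}. -/

import Mathlib

/-- The two-letter alphabet Σ = {a, b}. -/
inductive Letter : Type
  | a : Letter
  | b : Letter
deriving DecidableEq

/-- The syntactic (Myhill) congruence of a language L, as a setoid on Σ⁺. -/
def synSetoid (L : Set (List Letter)) : Setoid {u : List Letter // u ≠ []} where
  r u v := ∀ x y : List Letter, x ++ u.val ++ y ∈ L ↔ x ++ v.val ++ y ∈ L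
  iseqv := ⟨fun _ _ _ => Iff.rfl, fun h x y => (h x y).symm,
    fun h1 h2 x y => (h1 x y).trans (h2 x y)⟩

/-- The syntactic complexity of L: the cardinality of its syntactic semigroup Σ⁺/≈_L. -/
noncomputable def syntacticComplexity (L : Set (List Letter)) : ℕ :=
  Nat.card (Quotient (synSetoid L))

/-- The language Σ* w Σ* of all words containing w as a factor. -/
def factorLang (w : List Letter) : Set (List Letter) := {u : List Letter | w <:+: u}

/-- The set of inner factors of w: nonempty words u with w = t u s for nonempty t, s. -/
def innerFactors (w : List Letter) : Set (List Letter) :=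
  {u : List Letter | u ≠ [] ∧ ∃ t s : List Letter, t ≠ [] ∧ s ≠ [] ∧ w = t ++ u ++ s}

theorem infix_append_split {w x y : List Letter} (h : w <:+: x ++ y) :
    w <:+: x ∨ w <:+: y ∨ ∃ t s, t ≠ [] ∧ s ≠ [] ∧ w = t ++ s ∧ t <:+ x ∧ s <+: y := by
  obtain ⟨p, q, h⟩ := h
  rw [List.append_assoc, List.append_eq_append_iff] at h
  rcases h with ⟨r, hx, hr⟩ | ⟨r, hp, hy⟩
  · rw [List.append_eq_append_iff] at hr
    rcases hr with ⟨r2, h1, h2⟩ | ⟨r2, h1, h2⟩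
    · left
      exact ⟨p, r2, by rw [hx, h1]; simp⟩
    · by_cases hr0 : r = []
      · right; left
        subst hr0
        exact ⟨[], q, by simp [h2, h1]⟩
      · by_cases hr2 : r2 = []
        · left
          subst hr2
          exact ⟨p, [], by simp [hx, h1]⟩
        · right; right
          exact ⟨r, r2, hr0, hr2, h1, ⟨p, hx.symm⟩, ⟨q, h2.symm⟩⟩
  · right; left
    exact ⟨r, q, by rw [hy]; simp⟩

theorem prefix_append_split {q x y : List Letter} (h : q <+: x ++ y) :
    q <+: x ∨ ∃ r, r ≠ [] ∧ q = x ++ r ∧ r <+: y := by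
  obtain ⟨t, h⟩ := h
  rw [List.append_eq_append_iff] at h
  rcases h with ⟨r, hx, hr⟩ | ⟨r, hp, hy⟩
  · exact Or.inl ⟨r, hx.symm⟩
  · by_cases hr : r = []
    · left; subst hr; simp [hp]
    · exact Or.inr ⟨r, hr, hp, ⟨t, hy.symm⟩⟩

/-- No nonempty suffix of `w` is a prefix of a word starting with `z`. -/
def WSep (w z : List Letter) : Prop :=
  ∀ p r : List Letter, r ≠ [] → r <:+ w → ¬ r <+: z ++ p

theorem WSep.le {w z : List Letter} (h : WSep w z) {s p q : List Letter}
    (hq : q <:+ w) (hq' : q <+: s ++ (z ++ p)) : q.length ≤ s.length := by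
  rcases prefix_append_split hq' with h1 | ⟨r, hr, rfl, h1⟩
  · exact h1.length_le
  · exact absurd h1 (h p r hr ((List.suffix_append _ _).trans hq))

theorem WSep.le' {w z : List Letter} (h : WSep w.reverse z.reverse) {s p q : List Letter}
    (hq : q <+: w) (hq' : q <:+ s ++ (z ++ p)) : q.length ≤ p.length := by
  have := h.le (s := p.reverse) (p := s.reverse) (q := q.reverse)
    (List.reverse_suffix.2 hq) (by
      have := List.reverse_prefix.2 hq'
      simpa using this)
  simpa using this

theorem WSep.avoid {w z : List Letter} (h : WSep w z) (h' : WSep w.reverse z.reverse)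
    (h3 : ¬ w <:+: z) {s p : List Letter} (hs : s.length < w.length) (hp : p.length < w.length) :
    ¬ w <:+: s ++ (z ++ p) := by
  intro hw
  rcases infix_append_split hw with h1 | h1 | ⟨t1, t2, _, ht2, e, _, h2⟩
  · exact absurd h1.length_le (by omega)
  · rcases infix_append_split h1 with h1 | h1 | ⟨t1, t2, ht1, ht2, e, h1, h2⟩
    · exact h3 h1
    · exact absurd h1.length_le (by omega)
    · have : t1.length ≤ ([] : List Letter).length :=
        h'.le' (s := []) (p := []) (q := t1) ⟨t2, e.symm⟩ (by simpa using h1)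
      exact ht1 (List.length_eq_zero_iff.1 (by simpa using this))
  · exact h p t2 ht2 ⟨t1, e.symm⟩ h2

theorem right_le {w v : List Letter} {i i' : ℕ} (hi : i < w.length)
    (hv : ¬ w <:+: v) (hmax : ∀ q, q <+: w → q <:+ v → q.length ≤ i')
    (h : w <:+: v ++ w.drop i) : i ≤ i' := by
  rcases infix_append_split h with h1 | h1 | ⟨t1, t2, ht1, ht2, e, h1, h2⟩
  · exact absurd h1 hv
  · have := h1.length_le
    simp at this
    omega
  · have a1 := hmax t1 ⟨t2, e.symm⟩ h1
    have a2 := h2.length_le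
    have a3 := congrArg List.length e
    simp at a2 a3
    omega

theorem left_le {w v : List Letter} {j j' : ℕ} (hj : j < w.length)
    (hv : ¬ w <:+: v) (hmax : ∀ q, q <:+ w → q <+: v → q.length ≤ j')
    (h : w <:+: w.take (w.length - j) ++ v) : j ≤ j' := by
  rcases infix_append_split h with h1 | h1 | ⟨t1, t2, ht1, ht2, e, h1, h2⟩
  · have := h1.length_le
    simp at this
    omega
  · exact absurd h1 hv
  · have a1 := hmax t2 ⟨t1, e.symm⟩ h2
    have a2 := h1.length_le
    have a3 := congrArg List.length e
    simp at a2 a3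
    omega

/-- If a separator exists, then there are more than `n ^ 2` classes. -/
theorem big {w z : List Letter} (h : WSep w z) (h' : WSep w.reverse z.reverse)
    (h3 : ¬ w <:+: z) (hz : z ≠ []) (hw : w ≠ []) :
    syntacticComplexity (factorLang w) ≠ w.length ^ 2 := by
  intro hc
  unfold syntacticComplexity at hc
  have hpos : 0 < w.length := List.length_pos_iff.2 hw
  have hfin : Finite (Quotient (synSetoid (factorLang w))) :=
    Nat.finite_of_card_ne_zero (by rw [hc]; positivity)
  let U : Fin w.length × Fin w.length → List Letter := fun x =>
    w.drop (w.length - x.1) ++ (z ++ w.take x.2)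
  have hU : ∀ x, U x ≠ [] := by intro x; simp [U, hz]
  have hav : ∀ x, ¬ w <:+: U x := by
    rintro ⟨j, i⟩
    apply h.avoid h' h3 <;> simp <;> omega
  let f : Option (Fin w.length × Fin w.length) → Quotient (synSetoid (factorLang w)) := fun o =>
    match o with
    | none => Quotient.mk _ ⟨w, hw⟩
    | some x => Quotient.mk _ ⟨U x, hU x⟩
  have key : ∀ x y : Fin w.length × Fin w.length,
      (∀ s t : List Letter, w <:+: s ++ U x ++ t ↔ w <:+: s ++ U y ++ t) →
      (x.1 : ℕ) ≤ y.1 ∧ (x.2 : ℕ) ≤ y.2 := by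
    rintro ⟨j, i⟩ ⟨j', i'⟩ hxy
    constructor
    · apply left_le (w := w) j.2 (hav (j', i'))
      · intro q hq hq'
        have := h.le hq hq'
        simp at this
        simp
        omega
      · have := (hxy (w.take (w.length - j)) []).1 ⟨[], z ++ w.take i, by simp [U, ← List.append_assoc]⟩
        simpa using this
    · apply right_le (w := w) i.2 (hav (j', i'))
      · intro q hq hq'
        have := h'.le' hq hq'
        simp at this
        simp
        omega
      · have := (hxy [] (w.drop i)).1 ⟨w.drop (w.length - j) ++ z, [], by simp [U]⟩
        simpa using this
  have hinj : Function.Injective f := by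
    intro o o' hoo
    rcases o with _ | x <;> rcases o' with _ | y
    · rfl
    · exfalso
      have := (Quotient.exact hoo) [] []
      have h2 : w <:+: U y := by simpa [factorLang] using this
      exact hav y h2
    · exfalso
      have := (Quotient.exact hoo.symm) [] []
      have h2 : w <:+: U x := by simpa [factorLang] using this
      exact hav x h2
    · have h1 := Quotient.exact hoo
      have h2 := key x y (fun s t => h1 s t)
      have h4 := key y x (fun s t => (h1 s t).symm)
      congr 1
      ext <;> omega
  have := Nat.card_le_card_of_injective f hinj
  rw [hc, Nat.card_eq_fintype_card] at this
  simp at this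
  nlinarith

theorem sep_replicate {w t : List Letter} {c d : Letter} (hcd : c ≠ d) (w0 : List Letter)
    (hw : w = w0 ++ [c]) : WSep w (List.replicate w.length d ++ t) := by
  intro p r hr hrw hp
  obtain ⟨r0, x, rfl⟩ := List.eq_nil_or_concat' r |>.resolve_left hr
  have hx : x = c := by
    obtain ⟨u, hu⟩ := hrw
    rw [hw] at hu
    simp only [← List.append_assoc] at hu
    have := List.append_inj_right' hu rfl
    simpa using this
  subst hx
  have hl := hrw.length_le
  rw [List.append_assoc] at hp
  have : r0 ++ [x] <+: List.replicate w.length d :=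
    List.prefix_of_prefix_length_le hp (List.prefix_append _ _) (by simpa using hl)
  have hm : x ∈ List.replicate w.length d := this.subset (by simp)
  exact hcd (List.eq_of_mem_replicate hm)

theorem sep_abab {k l : ℕ} {c d : Letter} (hcd : c ≠ d) :
    WSep (List.replicate (k + 2) c ++ List.replicate (l + 2) d) [c, d, c, d] := by
  have hdc : d ≠ c := hcd.symm
  intro p r hr hrw hp
  have hlast : ∃ w0, List.replicate (k + 2) c ++ List.replicate (l + 2) d = w0 ++ [d, d] := by
    refine ⟨List.replicate (k + 2) c ++ List.replicate l d, ?_⟩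
    rw [List.replicate_add l 2]
    simp
  obtain ⟨w0, hw0⟩ := hlast
  match r, hr, hrw, hp with
  | [x], _, hrw, hp =>
    simp at hp
    subst hp
    obtain ⟨u, hu⟩ := hrw
    rw [hw0, show w0 ++ [d, d] = (w0 ++ [d]) ++ [d] by simp] at hu
    have := List.append_inj_right' hu rfl
    simp at this
    exact hcd this
  | [x, y], _, hrw, hp =>
    simp at hp
    obtain ⟨rfl, rfl⟩ := hp
    obtain ⟨u, hu⟩ := hrw
    rw [hw0] at hu
    have := List.append_inj_right' hu rfl
    simp at this
    exact hcd this
  | x :: y :: x' :: r, _, hrw, hp =>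
    simp at hp
    obtain ⟨rfl, rfl, rfl, hp⟩ := hp
    have hs : (List.Sublist [y, x'] (List.replicate (k + 2) x' ++ List.replicate (l + 2) y)) :=
      List.Sublist.trans (by simp) hrw.sublist
    obtain ⟨l1, l2, e, h1, h2⟩ := List.sublist_append_iff.1 hs
    rcases l1 with _ | ⟨z, l1⟩
    · simp at e
      subst e
      have : x' ∈ List.replicate (l + 2) y := h2.subset (by simp)
      exact hcd (List.eq_of_mem_replicate this)
    · simp at e
      obtain ⟨rfl, _⟩ := e
      have : y ∈ List.replicate (k + 2) x' := h1.subset (by simp)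
      exact hdc (List.eq_of_mem_replicate this)

theorem chain_form {c d : Letter} (hx : ∀ x : Letter, x = c ∨ x = d) (w : List Letter)
    (h : ¬ [d, c] <:+: w) : ∃ k l, w = List.replicate k c ++ List.replicate l d := by
  induction w with
  | nil => exact ⟨0, 0, rfl⟩
  | cons x w ih =>
    obtain ⟨k, l, rfl⟩ := ih (fun h' => h (h'.trans (List.suffix_cons _ _).isInfix))
    rcases hx x with rfl | rfl
    · exact ⟨k + 1, l, by simp [List.replicate_succ]⟩
    · rcases k with _ | k
      · exact ⟨0, l + 1, by simp [List.replicate_succ]⟩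
      · exact absurd ⟨[], List.replicate k c ++ List.replicate l x, by simp [List.replicate_succ]⟩ h

theorem case_same {w w0 w1 : List Letter} {c d : Letter} (hcd : c ≠ d)
    (h0 : w = w0 ++ [c]) (h1 : w = c :: w1) :
    syntacticComplexity (factorLang w) ≠ w.length ^ 2 := by
  have hw : w ≠ [] := by simp [h0]
  apply big (z := List.replicate w.length d) _ _ _ _ hw
  · simpa using sep_replicate (t := []) hcd w0 h0
  · have := sep_replicate (w := w.reverse) (t := []) hcd w1.reverse (by simp [h1])
    simpa using this
  · intro h
    have : c ∈ List.replicate w.length d := h.subset (by simp [h1])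
    exact hcd (List.eq_of_mem_replicate this)
  · simp [hw]

theorem case_diff {w w0 w1 : List Letter} {c d : Letter} (hcd : c ≠ d)
    (hx : ∀ x : Letter, x = c ∨ x = d)
    (h0 : w = w0 ++ [d]) (h1 : w = c :: w1)
    (hc : syntacticComplexity (factorLang w) = w.length ^ 2) :
    w = List.replicate (w.length - 1) c ++ [d] ∨ w = c :: List.replicate (w.length - 1) d := by
  have hw : w ≠ [] := by simp [h0]
  by_cases hba : [d, c] <:+: w
  · exfalso
    revert hc
    apply big (z := List.replicate w.length c ++ List.replicate w.length d) _ _ _ _ hw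
    · exact sep_replicate hcd.symm w0 h0
    · have := sep_replicate (w := w.reverse) (t := List.replicate w.length c) hcd w1.reverse
        (by simp [h1])
      simpa using this
    · intro h
      obtain ⟨l1, l2, e, h1, h2⟩ := List.sublist_append_iff.1 (hba.trans h).sublist
      rcases l1 with _ | ⟨z, l1⟩
      · simp at e
        subst e
        have : c ∈ List.replicate w.length d := h2.subset (by simp)
        exact hcd (List.eq_of_mem_replicate this)
      · simp at e
        obtain ⟨rfl, _⟩ := e
        have : d ∈ List.replicate w.length c := h1.subset (by simp)
        exact hcd.symm (List.eq_of_mem_replicate this)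
    · simp [hw]
  · obtain ⟨k, l, e⟩ := chain_form hx w hba
    have hcw : c ∈ w := by simp [h1]
    have hdw : d ∈ w := by simp [h0]
    match k, l, e with
    | 0, l, e =>
      rw [e] at hcw
      simp at hcw
      exact absurd hcw.2 hcd
    | k, 0, e =>
      rw [e] at hdw
      simp at hdw
      exact absurd hdw.2.symm hcd
    | 1, l, e => right; rw [e]; simp
    | k, 1, e => left; rw [e]; simp
    | k + 2, l + 2, e =>
      exfalso
      revert hc
      apply big (z := [c, d, c, d]) _ _ _ (by simp) hw
      · rw [e]; exact sep_abab hcd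
      · rw [e]
        have := sep_abab (k := l) (l := k) hcd.symm
        simpa using this
      · intro h
        have := h.eq_of_length_le (by rw [e]; simp; omega)
        rw [this] at hba
        exact hba ⟨[c], [d], rfl⟩

/-- Acceptance of `c ^ k ++ u` by the automaton looking for `c ^ m d`. -/
def acc (m : ℕ) (c : Letter) : ℕ → List Letter → Prop
  | _, [] => False
  | k, x :: u => (x = c ∧ acc m c (k + 1) u) ∨ (x ≠ c ∧ (m ≤ k ∨ acc m c 0 u))

theorem acc_rep (m : ℕ) (c : Letter) (r k : ℕ) (u : List Letter) :
    acc m c k (List.replicate r c ++ u) ↔ acc m c (k + r) u := by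
  induction r generalizing k with
  | zero => simp
  | succ r ih => simp [List.replicate_succ, acc, ih, Nat.add_assoc, Nat.add_comm 1 r]

theorem acc_cap (m : ℕ) (c : Letter) (k k' : ℕ) (hk : m ≤ k) (hk' : m ≤ k') (u : List Letter) :
    acc m c k u ↔ acc m c k' u := by
  induction u generalizing k k' with
  | nil => rfl
  | cons x u ih =>
    simp only [acc]
    rw [ih (k + 1) (k' + 1) (by omega) (by omega)]
    simp [hk, hk']

theorem acc_iff {m : ℕ} {c d : Letter} (hcd : c ≠ d) (hx : ∀ x : Letter, x = c ∨ x = d) (k : ℕ)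
    (u : List Letter) :
    acc m c k u ↔ (List.replicate m c ++ [d]) <:+: List.replicate k c ++ u := by
  have noc : ∀ k, ¬ (List.replicate m c ++ [d]) <:+: List.replicate k c := by
    intro k h
    have : d ∈ List.replicate k c := h.subset (by simp)
    exact hcd.symm (List.eq_of_mem_replicate this)
  induction u generalizing k with
  | nil => simpa [acc] using noc k
  | cons x u ih =>
    rcases hx x with rfl | rfl
    · simp only [acc, true_and, ne_eq, not_true_eq_false, false_and, or_false]
      refine (ih (k + 1)).trans ?_
      rw [List.replicate_succ']
      simp
    · simp only [acc, hcd.symm, false_and, ne_eq, not_false_eq_true, true_and, false_or]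
      refine (or_congr_right (ih 0)).trans ?_
      simp only [List.replicate_zero, List.nil_append]
      constructor
      · rintro (h | h)
        · refine ⟨List.replicate (k - m) c, u, ?_⟩
          obtain ⟨e, rfl⟩ := Nat.exists_eq_add_of_le' h
          rw [Nat.add_sub_cancel, List.replicate_add]
          simp only [List.append_assoc, List.cons_append, List.nil_append]
        · exact h.trans ⟨List.replicate k c ++ [x], [], by simp⟩
      · intro h
        rw [show List.replicate k c ++ x :: u = (List.replicate k c ++ [x]) ++ u by simp] at h
        rcases infix_append_split h with h | h | ⟨t, s, ht, hs, e, h1, h2⟩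
        · left
          have := h.length_le
          simp at this
          exact this
        · exact Or.inr h
        · exfalso
          obtain ⟨s0, y, rfl⟩ := List.eq_nil_or_concat' s |>.resolve_left hs
          obtain ⟨t0, z, rfl⟩ := List.eq_nil_or_concat' t |>.resolve_left ht
          have hz : z = x := by
            obtain ⟨u, hu⟩ := h1
            simp only [← List.append_assoc] at hu
            have := List.append_inj_right' hu rfl
            simpa using this
          subst hz
          rw [← List.append_assoc] at e
          have := List.append_inj_left' e rfl
          have h3 : z ∈ List.replicate m c := by rw [this]; simp
          exact hcd.symm (List.eq_of_mem_replicate h3)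

theorem acc_congr {m : ℕ} {c : Letter} {u v : List Letter}
    (h : ∀ k, acc m c k u ↔ acc m c k v) (x : List Letter) (k : ℕ) :
    acc m c k (x ++ u) ↔ acc m c k (x ++ v) := by
  induction x generalizing k with
  | nil => exact h k
  | cons y x ih => simp only [List.cons_append, acc, ih]

/-- Representatives of the classes. -/
def repw (m : ℕ) (c d : Letter) (j k : ℕ) : List Letter :=
  if j = m ∧ k ≠ 0 then List.replicate k c else List.replicate j c ++ d :: List.replicate k c

theorem acc_mid {m : ℕ} {c d : Letter} (hcd : c ≠ d) (i j k : ℕ) (y : List Letter) :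
    acc m c i (List.replicate j c ++ d :: List.replicate k c ++ y) ↔
      m ≤ i + j ∨ acc m c k y := by
  rw [List.append_assoc, acc_rep, List.cons_append]
  simp only [acc, acc_rep, hcd.symm, false_and, false_or, ne_eq, not_false_eq_true, true_and]
  simp

theorem acc_end {m : ℕ} {c d : Letter} (hcd : c ≠ d) (k l : ℕ) :
    acc m c k (List.replicate l c ++ [d]) ↔ m ≤ k + l := by
  rw [acc_rep]
  simp [acc, hcd.symm]

theorem exists_rep {m : ℕ} (hm : 1 ≤ m) {c d : Letter} (hcd : c ≠ d)
    (hx : ∀ x : Letter, x = c ∨ x = d) (u : List Letter) (hu : u ≠ []) :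
    ∃ j k, j ≤ m ∧ k ≤ m ∧
      ∀ i y, acc m c i (u ++ y) ↔ acc m c i (repw m c d j k ++ y) := by
  induction u using List.reverseRecOn with
  | nil => exact absurd rfl hu
  | append_singleton u x ih =>
    by_cases hu0 : u = []
    · subst hu0
      rcases hx x with rfl | rfl
      · exact ⟨m, 1, le_rfl, hm, by simp [repw]⟩
      · exact ⟨0, 0, by omega, by omega, by
          have : ¬ (0 = m) := by omega
          simp [repw]⟩
    · obtain ⟨j, k, hj, hk, h⟩ := ih hu0
      have h' : ∀ i y, acc m c i (u ++ [x] ++ y) ↔ acc m c i (repw m c d j k ++ ([x] ++ y)) := by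
        intro i y
        rw [List.append_assoc, h]
      simp only [h']
      by_cases hjk : j = m ∧ k ≠ 0
      · have e : repw m c d j k = List.replicate k c := by simp [repw, hjk]
        rw [e]
        rcases hx x with rfl | rfl
        · refine ⟨m, min (k + 1) m, le_rfl, min_le_right _ _, fun i y => ?_⟩
          have e2 : repw m x d m (min (k + 1) m) = List.replicate (min (k + 1) m) x := by
            simp [repw]; omega
          rw [e2, acc_rep, acc_rep]
          simp only [List.cons_append, List.nil_append, acc, true_and, ne_eq, not_true_eq_false,
            false_and, or_false]
          rcases Nat.lt_or_ge k m with hkm | hkm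
          · rw [min_eq_left (by omega)]; rfl
          · rw [min_eq_right (by omega)]
            exact acc_cap _ _ _ _ (by omega) (by omega) _
        · refine ⟨k, 0, hk, by omega, fun i y => ?_⟩
          simp [repw]
      · have e : repw m c d j k = List.replicate j c ++ d :: List.replicate k c := by
          simp [repw, hjk]
        rw [e]
        simp only [acc_mid hcd]
        by_cases hjm : j = m
        · refine ⟨m, 0, le_rfl, by omega, fun i y => ?_⟩
          have e2 : repw m c d m 0 = List.replicate m c ++ d :: List.replicate 0 c := by
            simp [repw]
          rw [e2, acc_mid hcd]
          simp [hjm]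
        rcases hx x with rfl | rfl
        · refine ⟨j, min (k + 1) m, hj, min_le_right _ _, fun i y => ?_⟩
          have e2 : repw m x d j (min (k + 1) m) =
              List.replicate j x ++ d :: List.replicate (min (k + 1) m) x := by
            simp [repw, hjm]
          rw [e2, acc_mid hcd]
          simp only [List.cons_append, List.nil_append, acc, true_and, ne_eq, not_true_eq_false,
            false_and, or_false]
          rcases Nat.lt_or_ge k m with hkm | hkm
          · rw [min_eq_left (by omega)]
          · rw [min_eq_right (by omega)]
            rw [acc_cap m x (k + 1) m (by omega) le_rfl]
        · by_cases hkm : k = m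
          · refine ⟨m, 0, le_rfl, by omega, fun i y => ?_⟩
            have e2 : repw m c x m 0 = List.replicate m c ++ x :: List.replicate 0 c := by
              simp [repw]
            rw [e2, acc_mid hcd]
            simp [acc, hkm, hcd.symm]
          · refine ⟨j, 0, hj, by omega, fun i y => ?_⟩
            have e2 : repw m c x j 0 = List.replicate j c ++ x :: List.replicate 0 c := by
              simp [repw]
            rw [e2, acc_mid hcd]
            have : ¬ m ≤ k := by omega
            simp [acc, this, hcd.symm]

theorem rep_inj {m : ℕ} {c d : Letter} (hcd : c ≠ d) {j k j' k' : ℕ}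
    (hj : j ≤ m) (hk : k ≤ m) (hj' : j' ≤ m) (hk' : k' ≤ m)
    (h : ∀ i y, acc m c i (repw m c d j k ++ y) ↔ acc m c i (repw m c d j' k' ++ y)) :
    j = j' ∧ k = k' := by
  have hnil : ∀ i, ¬ acc m c i [] := by intro i; simp [acc]
  by_cases h1 : j = m ∧ k ≠ 0 <;> by_cases h2 : j' = m ∧ k' ≠ 0
  · simp only [repw, h1, h2, ne_eq, not_false_eq_true, and_self, if_true, acc_rep] at h
    have a := h 0 (List.replicate (m - k) c ++ [d])
    have b := h 0 (List.replicate (m - k') c ++ [d])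
    rw [acc_end hcd, acc_end hcd] at a b
    omega
  · exfalso
    simp only [repw, if_pos h1, if_neg h2, acc_rep, acc_mid hcd] at h
    have a := h m []
    simp [hnil] at a
  · exfalso
    simp only [repw, if_pos h2, if_neg h1, acc_rep, acc_mid hcd] at h
    have a := h m []
    simp [hnil] at a
  · simp only [repw, if_neg h1, if_neg h2, acc_mid hcd] at h
    have a := h (m - j) []
    have b := h (m - j') []
    have a' := h 0 (List.replicate (m - k) c ++ [d])
    have b' := h 0 (List.replicate (m - k') c ++ [d])
    simp only [hnil, or_false] at a b
    rw [acc_end hcd, acc_end hcd] at a' b'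
    omega

theorem exact_card {m : ℕ} (hm : 1 ≤ m) {c d : Letter} (hcd : c ≠ d)
    (hx : ∀ x : Letter, x = c ∨ x = d) :
    syntacticComplexity (factorLang (List.replicate m c ++ [d])) = (m + 1) ^ 2 := by
  have hmem : ∀ u, u ∈ factorLang (List.replicate m c ++ [d]) ↔ acc m c 0 u := by
    intro u
    rw [acc_iff hcd hx]
    simp [factorLang]
  have hne : ∀ j k, repw m c d j k ≠ [] := by
    intro j k
    unfold repw
    split_ifs with h
    · simpa using h.2
    · simp
  let f : Fin (m + 1) × Fin (m + 1) →
      Quotient (synSetoid (factorLang (List.replicate m c ++ [d]))) := fun x =>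
    Quotient.mk _ ⟨repw m c d x.1 x.2, hne _ _⟩
  have hf : Function.Bijective f := by
    constructor
    · rintro ⟨j, k⟩ ⟨j', k'⟩ h
      have h1 := Quotient.exact h
      have := rep_inj hcd (Nat.le_of_lt_succ j.2) (Nat.le_of_lt_succ k.2)
        (Nat.le_of_lt_succ j'.2) (Nat.le_of_lt_succ k'.2) (fun i y => by
          have h2 := h1 (List.replicate i c) y
          simp only [hmem, List.append_assoc, acc_rep, Nat.zero_add] at h2
          exact h2)
      ext <;> simp [this]
    · intro q
      induction q using Quotient.inductionOn with
      | h u =>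
        obtain ⟨j, k, hj, hk, h⟩ := exists_rep hm hcd hx u.1 u.2
        refine ⟨(⟨j, by omega⟩, ⟨k, by omega⟩), ?_⟩
        apply Quotient.sound
        intro x y
        rw [hmem, hmem, List.append_assoc, List.append_assoc]
        exact acc_congr (fun i => (h i y).symm) x 0
  unfold syntacticComplexity
  rw [← Nat.card_congr (Equiv.ofBijective f hf), Nat.card_eq_fintype_card]
  simp [sq]

theorem complexity_reverse (w : List Letter) :
    syntacticComplexity (factorLang w.reverse) = syntacticComplexity (factorLang w) := by
  unfold syntacticComplexity
  let e : {u : List Letter // u ≠ []} ≃ {u : List Letter // u ≠ []} :=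
    { toFun := fun u => ⟨u.1.reverse, by simpa using u.2⟩
      invFun := fun u => ⟨u.1.reverse, by simpa using u.2⟩
      left_inv := fun u => by simp
      right_inv := fun u => by simp }
  have hr : ∀ v, v ∈ factorLang w.reverse ↔ v.reverse ∈ factorLang w := by
    intro v
    have := List.reverse_infix (l₁ := w) (l₂ := v.reverse)
    simp only [List.reverse_reverse] at this
    exact this
  refine Nat.card_congr (Quotient.congr e ?_)
  intro u v
  constructor
  · intro h x y
    have := h y.reverse x.reverse
    rw [hr, hr] at this
    simpa [e] using this
  · intro h x y
    have := h y.reverse x.reverse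
    rw [hr, hr]
    simpa [e] using this

/-- For n ≥ 2 and w of length n over Σ = {a,b}, σ(Σ* w Σ*) = n² if and only if
w ∈ {a^{n-1}b, ab^{n-1}, ba^{n-1}, b^{n-1}a}. -/
theorem stmt14 (n : ℕ) (hn : 2 ≤ n) (w : List Letter) (hlen : w.length = n) :
    syntacticComplexity (factorLang w) = n ^ 2 ↔
      (w = List.replicate (n - 1) Letter.a ++ [Letter.b] ∨
       w = Letter.a :: List.replicate (n - 1) Letter.b ∨
       w = Letter.b :: List.replicate (n - 1) Letter.a ∨
       w = List.replicate (n - 1) Letter.b ++ [Letter.a]) := by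
  have hxab : ∀ x : Letter, x = Letter.a ∨ x = Letter.b := by intro x; cases x <;> simp
  have hxba : ∀ x : Letter, x = Letter.b ∨ x = Letter.a := by intro x; cases x <;> simp
  have hab : Letter.a ≠ Letter.b := by simp
  have hba : Letter.b ≠ Letter.a := by simp
  subst hlen
  constructor
  · intro hc
    have hw : w ≠ [] := by rintro rfl; simp at hn
    obtain ⟨w0, y, h0⟩ := List.eq_nil_or_concat' w |>.resolve_left hw
    obtain ⟨x, w1, h1⟩ := List.exists_cons_of_ne_nil hw
    cases x <;> cases y
    · exact absurd hc (case_same hab h0 h1)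
    · have := case_diff hab hxab h0 h1 hc
      tauto
    · have := case_diff hba hxba h0 h1 hc
      tauto
    · exact absurd hc (case_same hba h0 h1)
  · generalize w.length = n at hn
    obtain ⟨m, rfl⟩ : ∃ m, n = m + 1 := ⟨n - 1, by omega⟩
    have hm : 1 ≤ m := by omega
    rintro (rfl | rfl | rfl | rfl)
    · exact exact_card hm hab hxab
    · rw [← complexity_reverse]
      simpa using exact_card hm hba hxba
    · rw [← complexity_reverse]
      simpa using exact_card hm hab hxab
    · exact exact_card hm hba hxba
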